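/- (Proposition 10.1 for base a compact hyperbolic surface: a Lipschitz harmonic foliation is a product.) Let Γ be a cocompact Fuchsian group and fix z₀ ∈ 𝔻. Let φ : 𝔻 × [0,1] → [0,1] satisfy: (i) for each t ∈ [0,1], z ↦ φ(z,t) is harmonic on 𝔻; (ii) for each z ∈ 𝔻, t ↦ φ(z,t) is a strictly increasing continuous bijection of [0,1] onto itself; (iii) φ is Lipschitz on E × [0,1] for every compact set E ⊆ 𝔻; (iv) the family of graphs is Γ-invariant: for every γ ∈ Γ and t ∈ [0,1] there exists t' ∈ [0,1] with φ(γ·z, t) = φ(z, t') for all z ∈ 𝔻; (v) φ(z₀,t) = t for all t. Then φ(z,t) = t for all z ∈ 𝔻 and t ∈ [0,1]; that is, the foliation is the product foliation. -/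

import Mathlib

open Metric Set Filter

noncomputable section

/-- The open unit disc in `ℂ`. -/
def unitDisc : Set ℂ := Metric.ball 0 1

/-- A function `f : ℂ → ℝ` is harmonic on a set `U ⊆ ℂ` if, locally on `U`, it is
the real part of a holomorphic function (for open `U` this is equivalent to being
`C²` with vanishing Laplacian). -/
def HarmonicOnSet (f : ℂ → ℝ) (U : Set ℂ) : Prop :=
  ∀ z ∈ U, ∃ r > 0, Metric.ball z r ⊆ U ∧
    ∃ g : ℂ → ℂ, DifferentiableOn ℂ g (Metric.ball z r) ∧
      ∀ w ∈ Metric.ball z r, f w = (g w).re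

/-- `ρ` is a cocompact Fuchsian group action of `Γ` on the open unit disc: a faithful,
properly discontinuous, cocompact action by Möbius transformations
`z ↦ (αz+β)/(β̄z+ᾱ)` with `|α|² - |β|² = 1`. -/
structure IsCocompactFuchsian (Γ : Type*) [Group Γ] (ρ : Γ → ℂ → ℂ) : Prop where
  one_act : ∀ z ∈ unitDisc, ρ 1 z = z
  mul_act : ∀ γ₁ γ₂ : Γ, ∀ z ∈ unitDisc, ρ (γ₁ * γ₂) z = ρ γ₁ (ρ γ₂ z)
  maps_disc : ∀ γ : Γ, ∀ z ∈ unitDisc, ρ γ z ∈ unitDisc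
  moebius : ∀ γ : Γ, ∃ α β : ℂ, ‖α‖ ^ 2 - ‖β‖ ^ 2 = 1 ∧
    ∀ z ∈ unitDisc, ρ γ z = (α * z + β) / ((starRingEnd ℂ) β * z + (starRingEnd ℂ) α)
  faithful : ∀ γ : Γ, (∀ z ∈ unitDisc, ρ γ z = z) → γ = 1
  properly_discontinuous : ∀ K : Set ℂ, K ⊆ unitDisc → IsCompact K →
    {γ : Γ | ((ρ γ '' K) ∩ K).Nonempty}.Finite
  cocompact : ∃ K : Set ℂ, K ⊆ unitDisc ∧ IsCompact K ∧ ∀ z ∈ unitDisc, ∃ γ : Γ, ρ γ z ∈ K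


open MeasureTheory in
theorem mass_transport {X Γ : Type*} [MeasurableSpace X] [Group Γ] [Countable Γ]
    (μ : Measure X) [SFinite μ] (act : Γ → X → X)
    (act_one : ∀ x, act 1 x = x) (act_mul : ∀ g h x, act (g * h) x = act g (act h x))
    (hmp : ∀ g, MeasurePreserving (act g) μ μ)
    (ψ : X → ENNReal) (hψ : Measurable ψ) (hsum : ∀ x, ∑' g, ψ (act g x) = 1)
    (f : X → X → ENNReal) (hf : Measurable (Function.uncurry f))
    (hinv : ∀ g x y, f (act g x) (act g y) = f x y) :
    ∫⁻ x, ψ x * ∫⁻ y, f x y ∂μ ∂μ = ∫⁻ x, ψ x * ∫⁻ y, f y x ∂μ ∂μ := by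
  have hma : ∀ g, Measurable (act g) := fun g => (hmp g).measurable
  have hf1 : ∀ x, Measurable (f x) := fun x => hf.comp measurable_prodMk_left
  have hf2 : ∀ y, Measurable (fun x => f x y) := fun y => hf.comp measurable_prodMk_right
  have hfs : Measurable (Function.uncurry fun y x => f x y) := hf.comp measurable_swap
  have hG : Measurable fun x => ∫⁻ w, ψ w * f x w ∂μ :=
    Measurable.lintegral_prod_right (f := fun x w => ψ w * f x w)
      ((hψ.comp measurable_snd).mul hf)
  calc ∫⁻ x, ψ x * ∫⁻ y, f x y ∂μ ∂μ
      = ∫⁻ x, ∑' g, ψ x * ∫⁻ y, ψ (act g y) * f x y ∂μ ∂μ := by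
        refine lintegral_congr fun x => ?_
        rw [ENNReal.tsum_mul_left, ← lintegral_tsum]
        · congr 1
          refine lintegral_congr fun y => ?_
          rw [ENNReal.tsum_mul_right, hsum, one_mul]
        · exact fun g => ((hψ.comp (hma g)).mul (hf1 x)).aemeasurable
    _ = ∑' g, ∫⁻ x, ψ x * ∫⁻ y, ψ (act g y) * f x y ∂μ ∂μ := by
        refine lintegral_tsum fun g => (hψ.mul ?_).aemeasurable
        exact Measurable.lintegral_prod_right (f := fun x w => ψ (act g w) * f x w)
          ((hψ.comp ((hma g).comp measurable_snd)).mul hf)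
    _ = ∑' g, ∫⁻ x, ψ (act g⁻¹ x) * ∫⁻ y, ψ y * f x y ∂μ ∂μ := by
        refine tsum_congr fun g => ?_
        have h1 : ∀ x, ∫⁻ y, ψ (act g y) * f x y ∂μ = ∫⁻ y, ψ y * f (act g x) y ∂μ := by
          intro x
          rw [← (hmp g).lintegral_comp (f := fun y => ψ y * f (act g x) y) (hψ.mul (hf1 _))]
          refine lintegral_congr fun y => ?_
          rw [hinv]
        simp_rw [h1]
        rw [← (hmp g).lintegral_comp (f := fun x => ψ (act g⁻¹ x) * ∫⁻ y, ψ y * f x y ∂μ)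
          ((hψ.comp (hma _)).mul hG)]
        refine lintegral_congr fun x => ?_
        rw [← act_mul, inv_mul_cancel, act_one]
    _ = ∫⁻ x, ∫⁻ y, ψ y * f x y ∂μ ∂μ := by
        rw [← lintegral_tsum (f := fun g x => ψ (act g⁻¹ x) * ∫⁻ y, ψ y * f x y ∂μ)
          (fun g => ((hψ.comp (hma _)).mul hG).aemeasurable)]
        refine lintegral_congr fun x => ?_
        rw [ENNReal.tsum_mul_right]
        have h1 : ∑' g : Γ, ψ (act g⁻¹ x) = ∑' g : Γ, ψ (act g x) :=
          (Equiv.inv Γ).tsum_eq (fun g => ψ (act g x))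
        rw [h1, hsum, one_mul]
    _ = ∫⁻ x, ψ x * ∫⁻ y, f y x ∂μ ∂μ := by
        rw [lintegral_lintegral_swap]
        · refine lintegral_congr fun x => ?_
          rw [lintegral_const_mul _ (hf2 x)]
        · exact ((hψ.comp measurable_snd).mul hf).aemeasurable

open MeasureTheory in
theorem integrable_of_bdd {X : Type*} [MeasurableSpace X] (μ : Measure X) [IsFiniteMeasure μ]
    (f : X → ℝ) (hf : Measurable f) (hb : ∀ x, |f x| ≤ 1) : Integrable f μ :=
  Integrable.of_bound hf.aestronglyMeasurable 1 (ae_of_all _ hb)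

open MeasureTheory unitInterval in
theorem layer (a : I) : ∫ s : I, (if s < a then 2 * (s : ℝ) else 0) = (a : ℝ) ^ 2 := by
  have h := integral_subtype (measurableSet_Icc : MeasurableSet (Icc (0:ℝ) 1))
    (fun s : ℝ => if s < (a : ℝ) then 2 * s else 0)
  have h' : ∫ s : I, (if s < a then 2 * (s : ℝ) else 0)
    = ∫ s : Icc (0:ℝ) 1, (if (s:ℝ) < (a : ℝ) then 2 * (s : ℝ) else 0) := rfl
  rw [h', h]
  have h2 : ∀ s : ℝ, (if s < (a : ℝ) then 2 * s else 0)
    = (Iio (a : ℝ)).indicator (fun s => 2 * s) s := fun s => by simp [indicator]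
  simp_rw [h2]
  rw [setIntegral_indicator measurableSet_Iio]
  have h3 : Icc (0:ℝ) 1 ∩ Iio (a : ℝ) = Ico 0 (a : ℝ) := by
    ext s; have := a.2.2; simp only [mem_inter_iff, mem_Icc, mem_Iio, mem_Ico]
    constructor
    · rintro ⟨⟨h1, h2⟩, h3⟩; exact ⟨h1, h3⟩
    · rintro ⟨h1, h2⟩; exact ⟨⟨h1, by linarith⟩, h2⟩
  rw [h3, integral_Ico_eq_integral_Ioc, ← intervalIntegral.integral_of_le a.2.1,
    intervalIntegral.integral_const_mul, integral_id]
  ring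

open MeasureTheory unitInterval in
theorem sq_integral : ∫ s : I, (s : ℝ) ^ 2 = 1 / 3 := by
  have h := integral_subtype (measurableSet_Icc : MeasurableSet (Icc (0:ℝ) 1))
    (fun s : ℝ => s ^ 2)
  have h' : ∫ s : I, (s : ℝ) ^ 2 = ∫ s : Icc (0:ℝ) 1, (s : ℝ) ^ 2 := rfl
  rw [h', h, integral_Icc_eq_integral_Ioc, ← intervalIntegral.integral_of_le zero_le_one,
    integral_pow]
  norm_num

open MeasureTheory unitInterval in
theorem layer' (a : I) : ∫ s : I, (if a < s then (1 : ℝ) else 0) = 1 - (a : ℝ) := by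
  have h2 : ∀ s : I, (if a < s then (1 : ℝ) else 0)
    = (Ioi a).indicator (fun s => (1:ℝ)) s := fun s => by simp [indicator]
  simp_rw [h2]
  rw [integral_indicator measurableSet_Ioi]
  simp [Measure.real, unitInterval.volume_Ioi, a.2.2]

open MeasureTheory unitInterval in
theorem iso_identity (e : I ≃o I) :
    ∫ x : I, (e x : ℝ) ^ 2 = 1 - 2 * ∫ s : I, (s : ℝ) * (e.symm s : ℝ) := by
  have hm : Measurable (fun x : I => (e.symm x : ℝ)) :=
    (continuous_subtype_val.comp e.symm.continuous).measurable
  have hS : MeasurableSet {p : I × I | p.2 < e p.1} :=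
    measurableSet_lt measurable_snd (e.continuous.measurable.comp measurable_fst)
  have hb : ∀ s : I, |(s : ℝ)| ≤ 1 := fun s => abs_le.2 ⟨by linarith [s.2.1], s.2.2⟩
  calc ∫ x : I, (e x : ℝ) ^ 2
      = ∫ x : I, ∫ s : I, (if s < e x then 2 * (s : ℝ) else 0) := by
        simp_rw [layer]
    _ = ∫ s : I, ∫ x : I, (if s < e x then 2 * (s : ℝ) else 0) := by
        apply integral_integral_swap
        refine Integrable.of_bound (C := 2) ?_ (ae_of_all _ ?_)
        · exact (Measurable.ite hS ((measurable_subtype_coe.comp measurable_snd).const_mul 2)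
            measurable_const).aestronglyMeasurable
        · rintro ⟨x, s⟩
          have := hb s
          simp only [Function.uncurry]
          split_ifs
          · rw [norm_mul]; simp only [Real.norm_eq_abs]; norm_num; linarith
          · simp
    _ = ∫ s : I, (2 * (s : ℝ) - 2 * ((s : ℝ) * (e.symm s : ℝ))) := by
        refine integral_congr_ae (ae_of_all _ fun s => ?_)
        have : ∀ x : I, (if s < e x then 2 * (s : ℝ) else 0)
            = 2 * (s : ℝ) * (if e.symm s < x then 1 else 0) := by
          intro x
          have : s < e x ↔ e.symm s < x := by
            rw [← e.symm.lt_iff_lt]; simp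
          simp [this]
        simp only [this]
        rw [integral_const_mul, layer']
        ring
    _ = 1 - 2 * ∫ s : I, (s : ℝ) * (e.symm s : ℝ) := by
        rw [integral_sub, integral_const_mul, integral_const_mul]
        · have := layer 1
          have h3 : ∫ s : I, (if s < 1 then 2 * (s : ℝ) else 0) = ∫ s : I, 2 * (s : ℝ) := by
            refine integral_congr_ae ?_
            have : ∀ᵐ s : I, s ≠ 1 := by simp [ae_iff]
            filter_upwards [this] with s hs
            simp [unitInterval.lt_one_iff_ne_one, hs]
          rw [h3, integral_const_mul] at this
          simp at this
          linarith
        · exact (integrable_of_bdd _ _ measurable_subtype_coe hb).const_mul 2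
        · refine (integrable_of_bdd _ _ (measurable_subtype_coe.mul hm) fun s => ?_).const_mul 2
          rw [Pi.mul_apply, abs_mul]
          exact mul_le_one₀ (hb _) (abs_nonneg _) (hb _)

open MeasureTheory unitInterval in
theorem unitInterval_isOpenPos : (volume : Measure I).IsOpenPosMeasure := by
  refine ⟨fun U hU hne h0 => ?_⟩
  obtain ⟨a, b, hab, hsub⟩ := hU.exists_Ioo_subset hne
  have h1 : volume (Ioo a b) = 0 := measure_mono_null hsub h0
  rw [unitInterval.volume_Ioo] at h1
  have h2 : (a : ℝ) < b := hab
  simp at h1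
  exact absurd h1 (not_le.2 hab)

open unitInterval Topology in
theorem symm_continuous {X : Type*} [TopologicalSpace X] (Φ : X → I ≃o I)
    (hΦ : Continuous fun p : X × I => Φ p.1 p.2) :
    Continuous fun p : X × I => (Φ p.1).symm p.2 := by
  rw [continuous_iff_continuousAt]
  rintro ⟨x, s⟩
  rw [ContinuousAt, tendsto_order]
  have hc : ∀ a : I, Continuous fun p : X × I => Φ p.1 a := fun a =>
    hΦ.comp (continuous_fst.prodMk continuous_const)
  constructor
  · intro a ha
    have h : Φ x a < s := by rw [← (Φ x).symm.lt_iff_lt]; simpa using ha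
    have := (hc a).continuousAt.eventually_lt (x₀ := (x, s)) continuous_snd.continuousAt h
    filter_upwards [this] with p hp
    rw [← (Φ p.1).lt_iff_lt]; simpa using hp
  · intro a ha
    have h : s < Φ x a := by rw [← (Φ x).symm.lt_iff_lt]; simpa using ha
    have := continuous_snd.continuousAt.eventually_lt (x₀ := (x, s)) (hc a).continuousAt h
    filter_upwards [this] with p hp
    rw [← (Φ p.1).lt_iff_lt]; simpa using hp

set_option maxHeartbeats 2000000 in
open MeasureTheory unitInterval in
theorem abstract_foliation {X Γ : Type*} [TopologicalSpace X] [SecondCountableTopology X]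
    [MeasurableSpace X] [BorelSpace X] [Group Γ] [Countable Γ]
    (μ : Measure X) [SFinite μ] (act : Γ → X → X)
    (act_one : ∀ x, act 1 x = x) (act_mul : ∀ g h x, act (g * h) x = act g (act h x))
    (hmp : ∀ g, MeasurePreserving (act g) μ μ)
    (ψ : X → ENNReal) (hψ : Measurable ψ) (hsum : ∀ x, ∑' g, ψ (act g x) = 1)
    (hψfin : ∫⁻ x, ψ x ∂μ ≠ ⊤)
    (S : Set (X × X)) (hS : MeasurableSet S) (hSsymm : ∀ x y, (x, y) ∈ S ↔ (y, x) ∈ S)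
    (hSinv : ∀ g x y, (act g x, act g y) ∈ S ↔ (x, y) ∈ S)
    (c : ENNReal) (hcfin : c ≠ ⊤) (hc : ∀ x, μ {y | (x, y) ∈ S} = c)
    (Φ : X → I ≃o I) (hΦ : Continuous fun p : X × I => Φ p.1 p.2)
    (hequi : ∀ g t, ∃ t', ∀ x, Φ (act g x) t = Φ x t')
    (hmean : ∀ x t, ∫ y in {y | (x, y) ∈ S}, (Φ y t : ℝ) ∂μ = c.toReal * (Φ x t : ℝ)) :
    ∀ᵐ x ∂μ, ∀ᵐ y ∂μ, (x, y) ∈ S → Φ y = Φ x := by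
  let h : X → X → I ≃o I := fun x y => (Φ x).symm.trans (Φ y)
  have hsy : ∀ x y, (h x y).symm = h y x := fun x y => rfl
  have hcont : Continuous fun p : (X × X) × I => h p.1.1 p.1.2 p.2 :=
    hΦ.comp ((continuous_snd.comp continuous_fst).prodMk
      ((symm_continuous Φ hΦ).comp ((continuous_fst.comp continuous_fst).prodMk continuous_snd)))
  have hcontR : Continuous fun p : (X × X) × I => (h p.1.1 p.1.2 p.2 : ℝ) :=
    continuous_subtype_val.comp hcont
  have hb : ∀ s : I, |(s : ℝ)| ≤ 1 := fun s => abs_le.2 ⟨by linarith [s.2.1], s.2.2⟩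
  have hinvh : ∀ g x y s, h (act g x) (act g y) s = h x y s := by
    intro g x y s
    obtain ⟨t', ht'⟩ := hequi g ((Φ (act g x)).symm s)
    have h1 : Φ x t' = s := by rw [← ht']; simp
    have h2 : (Φ x).symm s = t' := by rw [← h1]; simp
    change Φ (act g y) ((Φ (act g x)).symm s) = Φ y ((Φ x).symm s)
    rw [h2, ht']
  obtain ⟨C, hCdef⟩ : ∃ C : X → X → ℝ, ∀ x y, C x y = ∫ s : I, (h x y s : ℝ) ^ 2 :=
    ⟨_, fun _ _ => rfl⟩
  have hCmeas : Measurable (Function.uncurry C) := by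
    have : StronglyMeasurable (fun p : (X × X) × I => (h p.1.1 p.1.2 p.2 : ℝ) ^ 2) :=
      (hcontR.pow 2).measurable.stronglyMeasurable
    have h2 : Function.uncurry C = fun p : X × X => ∫ s : I, (h p.1 p.2 s : ℝ) ^ 2 :=
      funext fun p => hCdef p.1 p.2
    rw [h2]
    exact (this.integral_prod_right' (ν := volume)).measurable
  have hC0 : ∀ x y, 0 ≤ C x y := fun x y => by
    rw [hCdef]; exact integral_nonneg fun s => by positivity
  have hint2 : ∀ x y, Integrable (fun s : I => (h x y s : ℝ) ^ 2) := fun x y => by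
    refine integrable_of_bdd _ _
      ((continuous_subtype_val.comp (h x y).continuous).pow 2).measurable fun s => ?_
    rw [abs_pow]; exact pow_le_one₀ (abs_nonneg _) (hb _)
  have hC1 : ∀ x y, C x y ≤ 1 := fun x y => by
    calc C x y ≤ ∫ s : I, (1 : ℝ) := by
          rw [hCdef]
          refine integral_mono (hint2 x y) (integrable_const _) fun s => ?_
          exact pow_le_one₀ (h x y s).2.1 (h x y s).2.2
      _ = 1 := by simp
  have hCabs : ∀ x y, |C x y| ≤ 1 := fun x y => abs_le.2 ⟨by linarith [hC0 x y], hC1 x y⟩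
  have hCinv : ∀ g x y, C (act g x) (act g y) = C x y := fun g x y => by
    simp only [hCdef, hinvh]
  have hCid : ∀ x y, C x y = 1 - 2 * ∫ s : I, (s : ℝ) * (h y x s : ℝ) := fun x y => by
    rw [hCdef, iso_identity, hsy]
  let T : X → Set X := fun x => {y | (x, y) ∈ S}
  have hT : ∀ x, MeasurableSet (T x) := fun x => measurable_prodMk_left hS
  have hfin : ∀ x, IsFiniteMeasure (μ.restrict (T x)) := fun x =>
    ⟨by rw [Measure.restrict_apply_univ]; exact (hc x).trans_lt hcfin.lt_top⟩
  have hreal : ∀ x, (μ.restrict (T x)).real univ = c.toReal := fun x => by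
    rw [Measure.real, Measure.restrict_apply_univ, show μ (T x) = c from hc x]
  have hCm1 : ∀ x, Measurable (C x) := fun x => hCmeas.comp measurable_prodMk_left
  have hCm2 : ∀ x, Measurable (fun y => C y x) := fun x => hCmeas.comp measurable_prodMk_right
  have hmeanC : ∀ x, ∫ y in T x, C y x ∂μ = c.toReal / 3 := by
    intro x
    have := hfin x
    have hcx : Continuous fun p : X × I => (p.2 : ℝ) * (h x p.1 p.2 : ℝ) :=
      (continuous_subtype_val.comp continuous_snd).mul
        (hcontR.comp ((continuous_const.prodMk continuous_fst).prodMk continuous_snd))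
    have hI : Integrable (Function.uncurry fun (y : X) (s : I) => (s : ℝ) * (h x y s : ℝ))
        ((μ.restrict (T x)).prod volume) := by
      refine integrable_of_bdd _ _ hcx.measurable ?_
      rintro ⟨y, s⟩
      simp only [Function.uncurry]
      rw [abs_mul]; exact mul_le_one₀ (hb _) (abs_nonneg _) (hb _)
    simp_rw [hCid]
    have hJ : Integrable (fun y => 2 * ∫ s : I, (s : ℝ) * (h x y s : ℝ)) (μ.restrict (T x)) :=
      hI.integral_prod_left.const_mul 2
    rw [integral_sub (integrable_const _) hJ, integral_const_mul,
      integral_integral_swap hI]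
    have : ∀ s : I, ∫ y in T x, (s : ℝ) * (h x y s : ℝ) ∂μ = c.toReal * (s : ℝ) ^ 2 := by
      intro s
      rw [integral_const_mul]
      have := hmean x ((Φ x).symm s)
      rw [OrderIso.apply_symm_apply] at this
      change (s : ℝ) * ∫ y in {y | (x, y) ∈ S}, (Φ y ((Φ x).symm s) : ℝ) ∂μ = _
      rw [this]; ring
    simp_rw [this]
    rw [integral_const_mul, sq_integral, integral_const, hreal]
    simp; ring
  obtain ⟨D, hDdef⟩ : ∃ D : X → X → ℝ, ∀ x y, D x y = ∫ s : I, ((h x y s : ℝ) - s) ^ 2 :=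
    ⟨_, fun _ _ => rfl⟩
  have hint1 : ∀ x y, Integrable (fun s : I => (s : ℝ) * (h x y s : ℝ)) := fun x y => by
    refine integrable_of_bdd _ _ (continuous_subtype_val.mul
      (continuous_subtype_val.comp (h x y).continuous)).measurable fun s => ?_
    change |(s : ℝ) * (h x y s : ℝ)| ≤ 1
    rw [abs_mul]; exact mul_le_one₀ (hb _) (abs_nonneg _) (hb _)
  have hints : Integrable (fun s : I => (s : ℝ) ^ 2) := by
    refine integrable_of_bdd _ _ (continuous_subtype_val.pow 2).measurable fun s => ?_
    change |(s : ℝ) ^ 2| ≤ 1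
    rw [abs_pow]; exact pow_le_one₀ (abs_nonneg _) (hb _)
  have hD : ∀ x y, D x y = C x y + C y x - 2 / 3 := by
    intro x y
    have h1 : ∀ s : I, ((h x y s : ℝ) - s) ^ 2
      = (h x y s : ℝ) ^ 2 - 2 * ((s : ℝ) * (h x y s : ℝ)) + (s : ℝ) ^ 2 := fun s => by ring
    simp only [hDdef, h1]
    have hJ : Integrable (fun s : I => (h x y s : ℝ) ^ 2 - 2 * ((s : ℝ) * (h x y s : ℝ))) :=
      (hint2 x y).sub ((hint1 x y).const_mul 2)
    rw [integral_add hJ hints,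
      integral_sub (hint2 x y) ((hint1 x y).const_mul 2), integral_const_mul, sq_integral,
      hCid y x]
    rw [hCdef]; ring
  have hD0 : ∀ x y, 0 ≤ D x y := fun x y => by
    rw [hDdef]; exact integral_nonneg fun s => by positivity
  have hCint1 : ∀ x, IntegrableOn (C x) (T x) μ := fun x => by
    have := hfin x
    exact integrable_of_bdd _ _ (hCm1 x) (hCabs x)
  have hCint2 : ∀ x, IntegrableOn (fun y => C y x) (T x) μ := fun x => by
    have := hfin x
    exact integrable_of_bdd _ _ (hCm2 x) (fun y => hCabs y x)
  have hDint : ∀ x, IntegrableOn (D x) (T x) μ := fun x => by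
    have := hfin x
    have : D x = fun y => C x y + C y x - 2 / 3 := funext (hD x)
    rw [this]
    exact ((hCint1 x).add (hCint2 x)).sub (integrable_const _)
  have hE : ∀ x, ∫ y in T x, D x y ∂μ = ∫ y in T x, C x y ∂μ - c.toReal / 3 := by
    intro x
    have := hfin x
    simp_rw [hD]
    have hJ : Integrable (fun y => C x y + C y x) (μ.restrict (T x)) :=
      (hCint1 x).add (hCint2 x)
    rw [integral_sub hJ (integrable_const _),
      integral_add (hCint1 x) (hCint2 x), hmeanC, integral_const, hreal]
    simp; ring
  have hE0 : ∀ x, 0 ≤ ∫ y in T x, D x y ∂μ := fun x => integral_nonneg fun y => hD0 x y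
  let f : X → X → ENNReal := fun x y => S.indicator (fun p => ENNReal.ofReal (C p.1 p.2)) (x, y)
  have hf : Measurable (Function.uncurry f) :=
    (ENNReal.measurable_ofReal.comp hCmeas).indicator hS
  have hfinv : ∀ g x y, f (act g x) (act g y) = f x y := fun g x y => by
    by_cases hxy : (x, y) ∈ S
    · simp [f, indicator, hSinv, hxy, hCinv]
    · simp [f, indicator, hSinv, hxy]
  have hfl : ∀ x, ∫⁻ y, f x y ∂μ = ENNReal.ofReal (∫ y in T x, C x y ∂μ) := by
    intro x
    rw [ofReal_integral_eq_lintegral_ofReal (hCint1 x) (ae_of_all _ (hC0 x)),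
      ← lintegral_indicator (hT x)]
    rfl
  have hfr : ∀ x, ∫⁻ y, f y x ∂μ = ENNReal.ofReal (c.toReal / 3) := by
    intro x
    rw [← hmeanC x, ofReal_integral_eq_lintegral_ofReal (hCint2 x) (ae_of_all _ (fun y => hC0 y x)),
      ← lintegral_indicator (hT x)]
    refine lintegral_congr fun y => ?_
    by_cases hxy : (x, y) ∈ S
    · simp [f, indicator, T, hxy, hSsymm y x]
    · simp [f, indicator, T, hxy, hSsymm y x]
  have hmt := mass_transport μ act act_one act_mul hmp ψ hψ hsum f hf hfinv
  let F : X → ENNReal := fun x => ∫⁻ y, f x y ∂μ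
  have hFmeas : Measurable F := Measurable.lintegral_prod_right hf
  have hFinv : ∀ g x, F (act g x) = F x := by
    intro g x
    simp only [F]
    rw [← (hmp g).lintegral_comp (f := f (act g x)) (hf.comp measurable_prodMk_left)]
    simp_rw [hfinv]
  let e : X → ENNReal := fun x => F x - ENNReal.ofReal (c.toReal / 3)
  have hemeas : Measurable e := hFmeas.sub measurable_const
  have heF : ∀ x, F x = e x + ENNReal.ofReal (c.toReal / 3) := by
    intro x
    refine (tsub_add_cancel_of_le ?_).symm
    simp only [F]; rw [hfl]
    exact ENNReal.ofReal_le_ofReal (by linarith [hE x, hE0 x])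
  have heinv : ∀ g x, e (act g x) = e x := fun g x => by simp only [e, hFinv]
  have hzero : ∫⁻ x, ψ x * e x ∂μ = 0 := by
    have h1 : ∫⁻ x, ψ x * F x ∂μ
        = ∫⁻ x, ψ x * e x ∂μ + ∫⁻ x, ψ x * ENNReal.ofReal (c.toReal / 3) ∂μ := by
      rw [← lintegral_add_left (f := fun x => ψ x * e x) (hψ.mul hemeas)]
      refine lintegral_congr fun x => ?_
      rw [heF, mul_add]
    have h2 : ∫⁻ x, ψ x * F x ∂μ = ∫⁻ x, ψ x * ENNReal.ofReal (c.toReal / 3) ∂μ := by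
      simp only [F]; rw [hmt]; simp_rw [hfr]
    have h3 : ∫⁻ x, ψ x * ENNReal.ofReal (c.toReal / 3) ∂μ ≠ ⊤ := by
      rw [lintegral_mul_const _ hψ]; exact ENNReal.mul_ne_top hψfin ENNReal.ofReal_ne_top
    rw [h2] at h1
    have h4 : 0 + ∫⁻ x, ψ x * ENNReal.ofReal (c.toReal / 3) ∂μ
      = ∫⁻ x, ψ x * e x ∂μ + ∫⁻ x, ψ x * ENNReal.ofReal (c.toReal / 3) ∂μ := by rw [zero_add]; exact h1
    exact ((ENNReal.add_left_inj h3).1 h4).symm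
  have hae : ∀ᵐ x ∂μ, ψ x * e x = 0 := (lintegral_eq_zero_iff (hψ.mul hemeas)).1 hzero
  have hae2 : ∀ᵐ x ∂μ, ∀ g, ψ (act g x) * e (act g x) = 0 :=
    ae_all_iff.2 fun g => (hmp g).quasiMeasurePreserving.ae hae
  filter_upwards [hae2] with x hx
  have hex : e x = 0 := by
    calc e x = (∑' g, ψ (act g x)) * e x := by rw [hsum, one_mul]
      _ = ∑' g, ψ (act g x) * e (act g x) := by
        rw [← ENNReal.tsum_mul_right]; simp_rw [heinv]
      _ = 0 := by simp [hx]
  have hEx : ∫ y in T x, D x y ∂μ = 0 := by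
    have h1 := heF x
    rw [hex, zero_add] at h1
    simp only [F] at h1; rw [hfl] at h1
    have h2 : ∫ y in T x, C x y ∂μ = c.toReal / 3 := by
      rw [ENNReal.ofReal_eq_ofReal_iff] at h1
      · exact h1
      · exact integral_nonneg (hC0 x)
      · positivity
    rw [hE, h2, sub_self]
  have h5 := (integral_eq_zero_iff_of_nonneg (hD0 x) (hDint x)).1 hEx
  have h6 := (ae_restrict_iff' (hT x)).1 h5
  filter_upwards [h6] with y hy hxy
  have h7 : D x y = 0 := hy hxy
  rw [hDdef] at h7
  have hcd : Continuous fun s : I => ((h x y s : ℝ) - s) ^ 2 :=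
    ((continuous_subtype_val.comp (h x y).continuous).sub continuous_subtype_val).pow 2
  have h8 : (fun s : I => ((h x y s : ℝ) - s) ^ 2) = fun _ => 0 := by
    have hi : Integrable (fun s : I => ((h x y s : ℝ) - s) ^ 2) := by
      have h1 : (fun s : I => ((h x y s : ℝ) - s) ^ 2)
        = fun s => (h x y s : ℝ) ^ 2 - 2 * ((s : ℝ) * (h x y s : ℝ)) + (s : ℝ) ^ 2 := by
        funext s; ring
      rw [h1]
      exact ((hint2 x y).sub ((hint1 x y).const_mul 2)).add hints
    have h9 := (integral_eq_zero_iff_of_nonneg (fun s => by positivity) hi).1 h7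
    have := unitInterval_isOpenPos
    exact Continuous.ae_eq_iff_eq (volume : Measure I) hcd continuous_const |>.1 h9
  ext t
  have h10 := congrFun h8 (Φ x t)
  simp only [h, OrderIso.trans_apply, OrderIso.symm_apply_apply] at h10
  have := pow_eq_zero_iff (two_ne_zero) |>.1 h10
  linarith

/-- Moebius map of the disc. -/
def mob (α β z : ℂ) : ℂ := (α * z + β) / ((starRingEnd ℂ) β * z + (starRingEnd ℂ) α)

/-- Denominator of the Moebius map. -/
def mden (α β z : ℂ) : ℂ := (starRingEnd ℂ) β * z + (starRingEnd ℂ) α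

theorem norm_lt_of_mem {z : ℂ} (hz : z ∈ unitDisc) : ‖z‖ < 1 := by
  simpa [unitDisc] using hz

theorem mden_ne {α β z : ℂ} (h : ‖α‖ ^ 2 - ‖β‖ ^ 2 = 1) (hz : z ∈ unitDisc) : mden α β z ≠ 0 := by
  intro h0
  have hz1 := norm_lt_of_mem hz
  have h1 : (starRingEnd ℂ) α = - ((starRingEnd ℂ) β * z) := by
    rw [mden] at h0; linear_combination h0
  have h2 : ‖α‖ = ‖β‖ * ‖z‖ := by
    have := congrArg norm h1
    simpa using this
  have h3 : ‖α‖ ≤ ‖β‖ := by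
    rw [h2]; exact mul_le_of_le_one_right (norm_nonneg _) hz1.le
  nlinarith [norm_nonneg α, norm_nonneg β]

theorem conj_mul_real (α : ℂ) : α * (starRingEnd ℂ) α = ((‖α‖ ^ 2 : ℝ) : ℂ) := by
  rw [Complex.mul_conj, Complex.normSq_eq_norm_sq]

theorem det_cx {α β : ℂ} (h : ‖α‖ ^ 2 - ‖β‖ ^ 2 = 1) :
    α * (starRingEnd ℂ) α - β * (starRingEnd ℂ) β = 1 := by
  rw [conj_mul_real, conj_mul_real, ← Complex.ofReal_sub, h, Complex.ofReal_one]

theorem mob_sub {α β z w : ℂ} (h : ‖α‖ ^ 2 - ‖β‖ ^ 2 = 1) (hz : z ∈ unitDisc)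
    (hw : w ∈ unitDisc) :
    mob α β z - mob α β w = (z - w) / (mden α β z * mden α β w) := by
  have h1 := mden_ne h hz
  have h2 := mden_ne h hw
  have hd := det_cx h
  have e1 : mob α β z = (α * z + β) / mden α β z := rfl
  have e2 : mob α β w = (α * w + β) / mden α β w := rfl
  rw [e1, e2, div_sub_div _ _ h1 h2]
  congr 1
  simp only [mden]
  linear_combination (z - w) * hd

theorem mob_one_sub {α β z w : ℂ} (h : ‖α‖ ^ 2 - ‖β‖ ^ 2 = 1) (hz : z ∈ unitDisc)
    (hw : w ∈ unitDisc) :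
    1 - (starRingEnd ℂ) (mob α β z) * mob α β w
      = (1 - (starRingEnd ℂ) z * w) / ((starRingEnd ℂ) (mden α β z) * mden α β w) := by
  have h1 : (starRingEnd ℂ) (mden α β z) ≠ 0 := by simpa using mden_ne h hz
  have h2 := mden_ne h hw
  have hd := det_cx h
  have e1 : (starRingEnd ℂ) (mob α β z) = (starRingEnd ℂ) (α * z + β) / (starRingEnd ℂ) (mden α β z) := by
    rw [← map_div₀]; rfl
  have e2 : mob α β w = (α * w + β) / mden α β w := rfl
  rw [e1, e2, div_mul_div_comm, eq_div_iff (mul_ne_zero h1 h2), sub_mul,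
    div_mul_cancel₀ _ (mul_ne_zero h1 h2)]
  simp only [mden, map_add, map_mul, Complex.conj_conj]
  linear_combination (1 - (starRingEnd ℂ) z * w) * hd

theorem one_sub_norm_sq_mob {α β z : ℂ} (h : ‖α‖ ^ 2 - ‖β‖ ^ 2 = 1) (hz : z ∈ unitDisc) :
    1 - ‖mob α β z‖ ^ 2 = (1 - ‖z‖ ^ 2) / ‖mden α β z‖ ^ 2 := by
  have := mob_one_sub h hz hz
  rw [mul_comm, conj_mul_real, mul_comm ((starRingEnd ℂ) z), conj_mul_real,
    mul_comm _ (mden α β z), conj_mul_real] at this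
  exact_mod_cast this

theorem one_sub_norm_sq_pos {z : ℂ} (hz : z ∈ unitDisc) : 0 < 1 - ‖z‖ ^ 2 := by
  have := norm_lt_of_mem hz
  nlinarith [norm_nonneg z]

theorem mob_mem {α β z : ℂ} (h : ‖α‖ ^ 2 - ‖β‖ ^ 2 = 1) (hz : z ∈ unitDisc) :
    mob α β z ∈ unitDisc := by
  have h1 := one_sub_norm_sq_mob h hz
  have h2 : 0 < (1 - ‖z‖ ^ 2) / ‖mden α β z‖ ^ 2 :=
    div_pos (one_sub_norm_sq_pos hz) (by have := norm_pos_iff.2 (mden_ne h hz); positivity)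
  rw [← h1] at h2
  have : ‖mob α β z‖ < 1 := by nlinarith [norm_nonneg (mob α β z)]
  simpa [unitDisc] using this

theorem inv_det {α β : ℂ} (h : ‖α‖ ^ 2 - ‖β‖ ^ 2 = 1) :
    ‖(starRingEnd ℂ) α‖ ^ 2 - ‖-β‖ ^ 2 = 1 := by simpa using h

theorem mob_right_inv {α β z : ℂ} (h : ‖α‖ ^ 2 - ‖β‖ ^ 2 = 1) (hz : z ∈ unitDisc) :
    mob α β (mob ((starRingEnd ℂ) α) (-β) z) = z := by
  have h1 := mden_ne (inv_det h) hz
  have h2 := mden_ne h (mob_mem (inv_det h) hz)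
  have hd := det_cx h
  have e2 : mob ((starRingEnd ℂ) α) (-β) z = ((starRingEnd ℂ) α * z + -β) / mden ((starRingEnd ℂ) α) (-β) z := rfl
  have h3 : mob ((starRingEnd ℂ) α) (-β) z * mden ((starRingEnd ℂ) α) (-β) z = (starRingEnd ℂ) α * z + -β := by
    rw [e2, div_mul_cancel₀ _ h1]
  generalize mob ((starRingEnd ℂ) α) (-β) z = y at *
  have e3 : mob α β y = (α * y + β) / mden α β y := rfl
  rw [e3, div_eq_iff h2]
  apply mul_right_cancel₀ h1
  simp only [mden, map_neg, Complex.conj_conj] at h3 ⊢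
  linear_combination (α - (starRingEnd ℂ) β * z) * h3

theorem mob_injOn {α β : ℂ} (h : ‖α‖ ^ 2 - ‖β‖ ^ 2 = 1) : InjOn (mob α β) unitDisc := by
  intro z hz w hw hzw
  have := mob_sub h hz hw
  rw [hzw, sub_self, eq_comm, div_eq_zero_iff] at this
  rcases this with h1 | h1
  · exact sub_eq_zero.1 h1
  · exact absurd h1 (mul_ne_zero (mden_ne h hz) (mden_ne h hw))

theorem mob_image {α β : ℂ} (h : ‖α‖ ^ 2 - ‖β‖ ^ 2 = 1) : mob α β '' unitDisc = unitDisc := by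
  refine Subset.antisymm ?_ ?_
  · rintro _ ⟨z, hz, rfl⟩; exact mob_mem h hz
  · intro z hz
    exact ⟨_, mob_mem (inv_det h) hz, mob_right_inv h hz⟩

theorem mob_hasDerivAt {α β z : ℂ} (h : ‖α‖ ^ 2 - ‖β‖ ^ 2 = 1) (hz : z ∈ unitDisc) :
    HasDerivAt (mob α β) (1 / mden α β z ^ 2) z := by
  have h1 : HasDerivAt (fun z => α * z + β) α z := by
    simpa using ((hasDerivAt_id z).const_mul α).add_const β
  have h2 : HasDerivAt (fun z => mden α β z) ((starRingEnd ℂ) β) z := by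
    simpa [mden] using ((hasDerivAt_id z).const_mul ((starRingEnd ℂ) β)).add_const ((starRingEnd ℂ) α)
  have h3 := h1.fun_div h2 (mden_ne h hz)
  have h4 : (α * mden α β z - (α * z + β) * (starRingEnd ℂ) β) = 1 := by
    simp only [mden]; linear_combination det_cx h
  rw [h4] at h3
  exact h3

/-- Hyperbolic density. -/
def hdens (z : ℂ) : ENNReal := ENNReal.ofReal ((1 - ‖z‖ ^ 2)⁻¹ ^ 2)

theorem hdens_meas : Measurable hdens := by
  unfold hdens
  fun_prop

theorem unitDisc_open : IsOpen unitDisc := Metric.isOpen_ball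

open MeasureTheory in
/-- Hyperbolic measure on the disc. -/
def hypMeas : Measure unitDisc :=
  (Measure.comap Subtype.val (volume : Measure ℂ)).withDensity (fun z => hdens z)

open MeasureTheory in
theorem hypMeas_apply (A : Set unitDisc) (hA : MeasurableSet A) :
    hypMeas A = ∫⁻ z in unitDisc, (Subtype.val '' A).indicator hdens z := by
  have hm : MeasurableSet unitDisc := unitDisc_open.measurableSet
  rw [hypMeas, withDensity_apply _ hA, ← lintegral_indicator hA,
    ← lintegral_subtype_comap hm]
  refine lintegral_congr fun x => ?_
  by_cases hx : x ∈ A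
  · simp [indicator, hx]
  · simp [indicator, hx]

open MeasureTheory in
theorem mob_preserving {α β : ℂ} (h : ‖α‖ ^ 2 - ‖β‖ ^ 2 = 1) (f : unitDisc → unitDisc)
    (hf : ∀ z, (f z : ℂ) = mob α β z) (hfm : Measurable f) :
    MeasurePreserving f hypMeas hypMeas := by
  refine ⟨hfm, ?_⟩
  have hm : MeasurableSet unitDisc := unitDisc_open.measurableSet
  ext A hA
  rw [Measure.map_apply hfm hA, hypMeas_apply _ hA, hypMeas_apply _ (hfm hA)]
  let f' : ℂ → ℂ →L[ℝ] ℂ := fun z =>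
    (ContinuousLinearMap.toSpanSingleton ℂ (1 / mden α β z ^ 2)).restrictScalars ℝ
  have hder : ∀ z ∈ unitDisc, HasFDerivWithinAt (mob α β) (f' z) unitDisc z := fun z hz =>
    ((mob_hasDerivAt h hz).hasFDerivAt.restrictScalars ℝ).hasFDerivWithinAt
  have key := lintegral_image_eq_lintegral_abs_det_fderiv_mul volume hm hder (mob_injOn h)
    ((Subtype.val '' A).indicator hdens)
  rw [mob_image h] at key
  rw [key]
  refine setLIntegral_congr_fun hm fun z hz => ?_
  have hdet : (f' z).det = (‖mden α β z‖⁻¹) ^ 4 := by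
    simp only [f', ContinuousLinearMap.det]
    simp [LinearMap.det_restrictScalars, Algebra.norm_complex_eq, Complex.normSq_eq_norm_sq, ← pow_mul]
  have hmem : z ∈ Subtype.val '' (f ⁻¹' A) ↔ mob α β z ∈ Subtype.val '' A := by
    constructor
    · rintro ⟨x, hx, rfl⟩; exact ⟨f x, hx, hf x⟩
    · rintro ⟨y, hy, hyz⟩
      refine ⟨⟨z, hz⟩, ?_, rfl⟩
      have : f ⟨z, hz⟩ = y := Subtype.ext (by rw [hf, hyz])
      rw [mem_preimage, this]; exact hy
  by_cases hz' : mob α β z ∈ Subtype.val '' A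
  · rw [indicator_of_mem (hmem.2 hz'), indicator_of_mem hz', hdet, hdens, hdens,
      ← ENNReal.ofReal_mul (abs_nonneg _), one_sub_norm_sq_mob h hz]
    congr 1
    have := norm_pos_iff.2 (mden_ne h hz)
    have := one_sub_norm_sq_pos hz
    rw [abs_of_nonneg (by positivity)]
    field_simp
  · rw [indicator_of_notMem (fun h' => hz' (hmem.1 h')), indicator_of_notMem hz', mul_zero]

open MeasureTheory in
theorem hypMeas_lt_top (A : Set unitDisc) (hA : MeasurableSet A) (r : ℝ) (hr : r < 1)
    (hAr : ∀ z ∈ A, ‖(z : ℂ)‖ ≤ r) : hypMeas A < ⊤ := by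
  rw [hypMeas_apply A hA]
  have hle : ∀ z, (Subtype.val '' A).indicator hdens z ≤ ENNReal.ofReal ((1 - r ^ 2)⁻¹ ^ 2) := by
    intro z
    by_cases hz : z ∈ Subtype.val '' A
    · rw [indicator_of_mem hz]
      obtain ⟨x, hx, rfl⟩ := hz
      have h1 := hAr x hx
      have h0 := norm_nonneg (x : ℂ)
      have h2 : 0 < 1 - r ^ 2 := by nlinarith
      have h3 : 1 - r ^ 2 ≤ 1 - ‖(x : ℂ)‖ ^ 2 := by nlinarith
      apply ENNReal.ofReal_le_ofReal
      have h4 : 0 < 1 - ‖(x : ℂ)‖ ^ 2 := by linarith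
      gcongr
    · rw [indicator_of_notMem hz]; exact zero_le
  calc ∫⁻ z in unitDisc, (Subtype.val '' A).indicator hdens z
      ≤ ∫⁻ z in unitDisc, ENNReal.ofReal ((1 - r ^ 2)⁻¹ ^ 2) := lintegral_mono hle
    _ < ⊤ := by
      rw [setLIntegral_const]
      exact ENNReal.mul_lt_top ENNReal.ofReal_lt_top measure_ball_lt_top

open MeasureTheory in
theorem hypMeas_sfinite : SFinite hypMeas := by
  have hm : MeasurableSet unitDisc := unitDisc_open.measurableSet
  have : IsFiniteMeasure (Measure.comap Subtype.val (volume : Measure ℂ) : Measure unitDisc) :=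
    ⟨by
      rw [(MeasurableEmbedding.subtype_coe hm).comap_apply, image_univ, Subtype.range_coe]
      exact measure_ball_lt_top⟩
  unfold hypMeas
  infer_instance

/-- Moebius map on the disc subtype. -/
def mobX {α β : ℂ} (h : ‖α‖ ^ 2 - ‖β‖ ^ 2 = 1) (z : unitDisc) : unitDisc :=
  ⟨mob α β z, mob_mem h z.2⟩

theorem mob_differentiableOn {α β : ℂ} (h : ‖α‖ ^ 2 - ‖β‖ ^ 2 = 1) :
    DifferentiableOn ℂ (mob α β) unitDisc := fun _ hz =>
  (mob_hasDerivAt h hz).differentiableAt.differentiableWithinAt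

theorem mobX_continuous {α β : ℂ} (h : ‖α‖ ^ 2 - ‖β‖ ^ 2 = 1) : Continuous (mobX h) :=
  Continuous.subtype_mk (continuousOn_iff_continuous_domRestrict.1 (mob_differentiableOn h).continuousOn) _

/-- Pairs of points at bounded hyperbolic distance. -/
def nearS : Set (unitDisc × unitDisc) :=
  {p | 2 * ‖(p.1 : ℂ) - p.2‖ < ‖1 - (starRingEnd ℂ) (p.1 : ℂ) * p.2‖}

theorem nearS_open : IsOpen nearS := by
  apply isOpen_lt
  · fun_prop
  · have : Continuous (starRingEnd ℂ) := Complex.continuous_conj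
    fun_prop

theorem nearS_symm (x y : unitDisc) : (x, y) ∈ nearS ↔ (y, x) ∈ nearS := by
  simp only [nearS, mem_ofPred_eq]
  rw [norm_sub_rev]
  have : ‖1 - (starRingEnd ℂ) (x : ℂ) * y‖ = ‖1 - (starRingEnd ℂ) (y : ℂ) * x‖ := by
    rw [← Complex.norm_conj (1 - (starRingEnd ℂ) (x : ℂ) * y)]
    simp [mul_comm]
  rw [this]

theorem nearS_self (x : unitDisc) : (x, x) ∈ nearS := by
  simp only [nearS, mem_ofPred_eq]
  rw [sub_self, norm_zero, mul_zero, mul_comm, conj_mul_real, norm_pos_iff]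
  have := one_sub_norm_sq_pos x.2
  have h2 : (1 : ℂ) - ((‖(x : ℂ)‖ ^ 2 : ℝ) : ℂ) = ((1 - ‖(x : ℂ)‖ ^ 2 : ℝ) : ℂ) := by push_cast; ring
  rw [h2]
  exact_mod_cast this.ne'

theorem nearS_mob {α β : ℂ} (h : ‖α‖ ^ 2 - ‖β‖ ^ 2 = 1) (x y x' y' : unitDisc)
    (hx : (x' : ℂ) = mob α β x) (hy : (y' : ℂ) = mob α β y) :
    (x', y') ∈ nearS ↔ (x, y) ∈ nearS := by
  simp only [nearS, mem_ofPred_eq]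
  rw [hx, hy, mob_sub h x.2 y.2, mob_one_sub h x.2 y.2]
  have h1 := norm_pos_iff.2 (mden_ne h x.2)
  have h2 := norm_pos_iff.2 (mden_ne h y.2)
  rw [norm_div, norm_div, norm_mul, norm_mul, Complex.norm_conj, ← mul_div_assoc]
  exact div_lt_div_iff_of_pos_right (mul_pos h1 h2)

/-- The center. -/
def zeroX : unitDisc := ⟨0, by simp [unitDisc]⟩

theorem exists_translation (x : unitDisc) : ∃ α β : ℂ, ‖α‖ ^ 2 - ‖β‖ ^ 2 = 1 ∧
    mob α β 0 = x := by
  have hp := one_sub_norm_sq_pos x.2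
  set s : ℝ := Real.sqrt (1 - ‖(x : ℂ)‖ ^ 2) with hs
  have hs0 : 0 < s := Real.sqrt_pos.2 hp
  have hs2 : s ^ 2 = 1 - ‖(x : ℂ)‖ ^ 2 := Real.sq_sqrt hp.le
  refine ⟨((s⁻¹ : ℝ) : ℂ), ((s⁻¹ : ℝ) : ℂ) * x, ?_, ?_⟩
  · rw [norm_mul, Complex.norm_real, Real.norm_eq_abs, abs_of_pos (inv_pos.2 hs0)]
    have : s⁻¹ ^ 2 * s ^ 2 = 1 := by field_simp
    rw [hs2] at this
    linarith
  · have hne : (((s⁻¹ : ℝ) : ℂ)) ≠ 0 := by exact_mod_cast (inv_pos.2 hs0).ne'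
    simp only [mob, mul_zero, zero_add, Complex.conj_ofReal]
    rw [mul_comm, mul_div_assoc, div_self hne, mul_one]

open MeasureTheory in
theorem slice_meas (x : unitDisc) : MeasurableSet {y | (x, y) ∈ nearS} :=
  measurable_prodMk_left nearS_open.measurableSet

open MeasureTheory in
theorem slice_zero_lt_top : hypMeas {y | (zeroX, y) ∈ nearS} < ⊤ := by
  refine hypMeas_lt_top _ (slice_meas _) (1 / 2) (by norm_num) fun z hz => ?_
  simp [nearS, zeroX] at hz
  linarith

open MeasureTheory in
theorem slice_eq (x : unitDisc) :
    hypMeas {y | (x, y) ∈ nearS} = hypMeas {y | (zeroX, y) ∈ nearS} := by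
  obtain ⟨α, β, h, h0⟩ := exists_translation x
  have hmp := mob_preserving h (mobX h) (fun _ => rfl) (mobX_continuous h).measurable
  rw [← hmp.measure_preimage (slice_meas x).nullMeasurableSet]
  congr 1
  ext y
  exact nearS_mob h zeroX y x (mobX h y) h0.symm rfl

theorem harmonic_circle (u : ℂ → ℝ) (hu : HarmonicOnSet u unitDisc) {α β : ℂ}
    (h : ‖α‖ ^ 2 - ‖β‖ ^ 2 = 1) (y : ℂ) (hy : y ∈ unitDisc) :
    ∫ θ in (0 : ℝ)..2 * Real.pi, u (mob α β (Complex.exp (θ * Complex.I) * y))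
      = 2 * Real.pi * u (mob α β 0) := by
  have hharm : InnerProductSpace.HarmonicOnNhd (fun ζ : ℂ => u (mob α β (ζ * y)))
      (closedBall 0 |1|) := by
    intro ζ hζ
    have hζ1 : ‖ζ‖ ≤ 1 := by simpa using hζ
    have hm : ζ * y ∈ unitDisc := by
      have := norm_lt_of_mem hy
      have h2 : ‖ζ * y‖ < 1 := by
        rw [norm_mul]; nlinarith [norm_nonneg y, norm_nonneg ζ]
      simpa [unitDisc] using h2
    obtain ⟨r, hr, hsub, g, hg, hgu⟩ := hu _ (mob_mem h hm)
    have ha1 : AnalyticAt ℂ (fun ζ : ℂ => ζ * y) ζ := by fun_prop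
    have ha2 : AnalyticAt ℂ (mob α β) (ζ * y) :=
      (mob_differentiableOn h).analyticAt (unitDisc_open.mem_nhds hm)
    have ha3 : AnalyticAt ℂ g (mob α β (ζ * y)) := hg.analyticAt (ball_mem_nhds _ hr)
    have ha12 : AnalyticAt ℂ (fun ζ : ℂ => mob α β (ζ * y)) ζ := 
      AnalyticAt.fun_comp (g := mob α β) (f := fun ζ : ℂ => ζ * y) (x := ζ) ha2 ha1
    have ha : AnalyticAt ℂ (fun ζ : ℂ => g (mob α β (ζ * y))) ζ := 
      AnalyticAt.fun_comp (g := g) (f := fun ζ : ℂ => mob α β (ζ * y)) (x := ζ) ha3 ha12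
    refine (InnerProductSpace.harmonicAt_congr_nhds ?_).2 ha.harmonicAt_re
    filter_upwards [ha12.continuousAt.preimage_mem_nhds (ball_mem_nhds _ hr)] with ζ' hζ'
    exact hgu _ hζ'
  have hca := hharm.circleAverage_eq
  rw [Real.circleAverage_def] at hca
  simp only [circleMap, zero_mul, Complex.ofReal_one, one_mul, zero_add, smul_eq_mul] at hca
  rw [← hca, ← mul_assoc, mul_inv_cancel₀ (by positivity), one_mul]

theorem rot_det (θ : ℝ) : ‖Complex.exp ((θ / 2 : ℝ) * Complex.I)‖ ^ 2 - ‖(0 : ℂ)‖ ^ 2 = 1 := by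
  rw [Complex.norm_exp_ofReal_mul_I]; simp

theorem rot_eq (θ : ℝ) (z : ℂ) :
    mob (Complex.exp ((θ / 2 : ℝ) * Complex.I)) 0 z = Complex.exp (θ * Complex.I) * z := by
  simp only [mob, map_zero, zero_mul, zero_add, add_zero]
  rw [← Complex.exp_conj, map_mul, Complex.conj_I, Complex.conj_ofReal, mul_neg, Complex.exp_neg,
    div_inv_eq_mul, mul_right_comm, ← Complex.exp_add]
  congr 2
  push_cast; ring

open MeasureTheory in
theorem mean_value (u : ℂ → ℝ) (hu : HarmonicOnSet u unitDisc) (huc : ContinuousOn u unitDisc)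
    (hub : ∀ z ∈ unitDisc, |u z| ≤ 1) (x : unitDisc) :
    ∫ y in {y | (x, y) ∈ nearS}, u y ∂hypMeas
      = (hypMeas {y | (zeroX, y) ∈ nearS}).toReal * u x := by
  have := hypMeas_sfinite
  obtain ⟨α, β, h, h0⟩ := exists_translation x
  have hmp := mob_preserving h (mobX h) (fun _ => rfl) (mobX_continuous h).measurable
  have hucX : Continuous (fun y : unitDisc => u y) := continuousOn_iff_continuous_domRestrict.1 huc
  set S0 : Set unitDisc := {y | (zeroX, y) ∈ nearS} with hS0
  have hS0m : MeasurableSet S0 := slice_meas _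
  have hfin : IsFiniteMeasure (hypMeas.restrict S0) :=
    ⟨by rw [Measure.restrict_apply_univ]; exact slice_zero_lt_top⟩
  have hrotX : ∀ (θ : ℝ) (y : unitDisc), Complex.exp (θ * Complex.I) * (y : ℂ) ∈ unitDisc := by
    intro θ y
    rw [← rot_eq]; exact mob_mem (rot_det θ) y.2
  have step : ∀ θ : ℝ, ∫ y in {y | (x, y) ∈ nearS}, u y ∂hypMeas
      = ∫ y in S0, u (mob α β (Complex.exp (θ * Complex.I) * y)) ∂hypMeas := by
    intro θ
    have hr := mob_preserving (rot_det θ) (mobX (rot_det θ)) (fun _ => rfl)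
      (mobX_continuous (rot_det θ)).measurable
    have hcomp := hmp.comp hr
    have e1 := setIntegral_map (slice_meas x) (f := fun y : unitDisc => u y)
      (μ := hypMeas) (g := mobX h ∘ mobX (rot_det θ))
      hucX.measurable.aestronglyMeasurable hcomp.measurable.aemeasurable
    rw [hcomp.map_eq] at e1
    rw [e1]
    have e2 : (mobX h ∘ mobX (rot_det θ)) ⁻¹' {y | (x, y) ∈ nearS} = S0 := by
      ext y
      have a1 := nearS_mob h zeroX (mobX (rot_det θ) y) x (mobX h (mobX (rot_det θ) y)) h0.symm rfl
      have a2 := nearS_mob (rot_det θ) zeroX y zeroX (mobX (rot_det θ) y)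
        (by rw [rot_eq]; simp [zeroX]) rfl
      exact a1.trans a2
    rw [e2]
    refine integral_congr_ae (ae_of_all _ fun y => ?_)
    simp only [Function.comp, mobX]
    rw [rot_eq]
  have hcont : Continuous (fun p : ℝ × unitDisc =>
      u (mob α β (Complex.exp (p.1 * Complex.I) * p.2))) := by
    have c1 : Continuous (fun p : ℝ × unitDisc =>
      (⟨Complex.exp (p.1 * Complex.I) * p.2, hrotX p.1 p.2⟩ : unitDisc)) :=
      Continuous.subtype_mk (by fun_prop) _
    exact hucX.comp ((mobX_continuous h).comp c1)
  have hpi : (0 : ℝ) ≤ 2 * Real.pi := by positivity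
  have hI : Integrable (Function.uncurry fun (θ : ℝ) (y : unitDisc) =>
      u (mob α β (Complex.exp (θ * Complex.I) * y)))
      ((volume.restrict (Ioc 0 (2 * Real.pi))).prod (hypMeas.restrict S0)) := by
    refine integrable_of_bdd _ _ hcont.measurable ?_
    rintro ⟨θ, y⟩
    exact hub _ (mob_mem h (hrotX θ y))
  have hsw := integral_integral_swap hI
  have l1 : ∫ θ in Ioc 0 (2 * Real.pi), ∫ y in S0,
      u (mob α β (Complex.exp (θ * Complex.I) * y)) ∂hypMeas
      = 2 * Real.pi * ∫ y in {y | (x, y) ∈ nearS}, u y ∂hypMeas := by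
    simp_rw [← step]
    rw [setIntegral_const]
    simp [hpi]
  have l2 : ∫ y in S0, (∫ θ in Ioc 0 (2 * Real.pi),
      u (mob α β (Complex.exp (θ * Complex.I) * y))) ∂hypMeas
      = (hypMeas S0).toReal * (2 * Real.pi * u x) := by
    have : ∀ y : unitDisc, ∫ θ in Ioc 0 (2 * Real.pi),
      u (mob α β (Complex.exp (θ * Complex.I) * y)) = 2 * Real.pi * u x := by
      intro y
      rw [← intervalIntegral.integral_of_le hpi, harmonic_circle u hu h y y.2, h0]
    simp_rw [this]
    rw [setIntegral_const]; rfl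
  rw [l1, l2] at hsw
  have : (2 * Real.pi) ≠ 0 := by positivity
  apply mul_left_cancel₀ this
  rw [hsw]; ring

open MeasureTheory in
theorem hypMeas_openPos : Measure.IsOpenPosMeasure hypMeas := by
  have hm : MeasurableSet unitDisc := unitDisc_open.measurableSet
  refine ⟨fun U hU hne h0 => ?_⟩
  have hd : Measurable (fun z : unitDisc => hdens z) := hdens_meas.comp measurable_subtype_coe
  rw [hypMeas, withDensity_apply_eq_zero hd] at h0
  have huniv : {x : unitDisc | hdens x ≠ 0} ∩ U = U := by
    refine inter_eq_right.2 fun x _ => ?_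
    have := one_sub_norm_sq_pos x.2
    simp only [mem_ofPred_eq, hdens, ne_eq, ENNReal.ofReal_eq_zero, not_le]
    positivity
  rw [huniv, (MeasurableEmbedding.subtype_coe hm).comap_apply] at h0
  exact (unitDisc_open.isOpenMap_subtype_val U hU).measure_ne_zero volume (hne.image _) h0

theorem compact_norm_bound (K : Set ℂ) (hK : K ⊆ unitDisc) (hKc : IsCompact K) :
    ∃ r < 1, ∀ z ∈ K, ‖z‖ ≤ r := by
  rcases K.eq_empty_or_nonempty with rfl | hne
  · exact ⟨0, by norm_num, by simp⟩
  · obtain ⟨w, hw, hmax⟩ := hKc.exists_isMaxOn hne (continuous_norm.continuousOn (s := K))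
    exact ⟨‖w‖, norm_lt_of_mem (hK hw), fun z hz => hmax hz⟩

theorem fuchsian_finite {Γ : Type*} [Group Γ] {ρ : Γ → ℂ → ℂ} (hΓ : IsCocompactFuchsian Γ ρ)
    (K : Set ℂ) (hK : K ⊆ unitDisc) (hKc : IsCompact K) (x : ℂ) (hx : x ∈ unitDisc) :
    {γ : Γ | ρ γ x ∈ K}.Finite := by
  refine (hΓ.properly_discontinuous (insert x K) (insert_subset hx hK)
    (hKc.insert x)).subset fun γ hγ => ?_
  exact ⟨ρ γ x, ⟨x, mem_insert _ _, rfl⟩, mem_insert_of_mem _ hγ⟩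

theorem fuchsian_countable {Γ : Type*} [Group Γ] {ρ : Γ → ℂ → ℂ}
    (hΓ : IsCocompactFuchsian Γ ρ) : Countable Γ := by
  have h0 : (0 : ℂ) ∈ unitDisc := by simp [unitDisc]
  have hr : ∀ n : ℕ, closedBall (0 : ℂ) (1 - 1 / ((n : ℝ) + 1)) ⊆ unitDisc := fun n =>
    closedBall_subset_ball (by
      have : (0 : ℝ) < 1 / ((n : ℝ) + 1) := by positivity
      linarith)
  have hU : (⋃ n : ℕ, {γ : Γ | ρ γ 0 ∈ closedBall (0 : ℂ) (1 - 1 / ((n : ℝ) + 1))}) = univ := by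
    refine eq_univ_of_forall fun γ => mem_iUnion.2 ?_
    have h1 := norm_lt_of_mem (hΓ.maps_disc γ 0 h0)
    obtain ⟨n, hn⟩ := exists_nat_one_div_lt (sub_pos.2 h1)
    refine ⟨n, ?_⟩
    simp only [mem_ofPred_eq, mem_closedBall, dist_zero_right]
    linarith
  rw [← countable_univ_iff, ← hU]
  exact countable_iUnion fun n =>
    (fuchsian_finite hΓ _ (hr n) (isCompact_closedBall _ _) 0 h0).countable

/-- The action on the disc subtype. -/
def fact {Γ : Type*} [Group Γ] {ρ : Γ → ℂ → ℂ} (hΓ : IsCocompactFuchsian Γ ρ) (γ : Γ)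
    (x : unitDisc) : unitDisc := ⟨ρ γ x, hΓ.maps_disc γ x x.2⟩

theorem fact_mob {Γ : Type*} [Group Γ] {ρ : Γ → ℂ → ℂ} (hΓ : IsCocompactFuchsian Γ ρ) (γ : Γ) :
    ∃ (α β : ℂ) (h : ‖α‖ ^ 2 - ‖β‖ ^ 2 = 1), fact hΓ γ = mobX h := by
  obtain ⟨α, β, h, hz⟩ := hΓ.moebius γ
  refine ⟨α, β, h, funext fun x => Subtype.ext ?_⟩
  exact hz x x.2

theorem fact_continuous {Γ : Type*} [Group Γ] {ρ : Γ → ℂ → ℂ} (hΓ : IsCocompactFuchsian Γ ρ)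
    (γ : Γ) : Continuous (fact hΓ γ) := by
  obtain ⟨α, β, h, e⟩ := fact_mob hΓ γ
  rw [e]; exact mobX_continuous h

open MeasureTheory in
theorem exists_weight {Γ : Type*} [Group Γ] {ρ : Γ → ℂ → ℂ} (hΓ : IsCocompactFuchsian Γ ρ) :
    ∃ ψ : unitDisc → ENNReal, Measurable ψ ∧ (∀ x, ∑' g, ψ (fact hΓ g x) = 1) ∧
      ∫⁻ x, ψ x ∂hypMeas ≠ ⊤ := by
  have := fuchsian_countable hΓ
  obtain ⟨K, hK, hKc, hcov⟩ := hΓ.cocompact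
  set K' : Set unitDisc := Subtype.val ⁻¹' K with hK'
  have hK'm : MeasurableSet K' := measurable_subtype_coe hKc.measurableSet
  let χ : unitDisc → ENNReal := K'.indicator 1
  have hχ : Measurable χ := measurable_one.indicator hK'm
  let N : unitDisc → ENNReal := fun x => ∑' g, χ (fact hΓ g x)
  have hN : Measurable N := Measurable.ennreal_tsum fun g =>
    hχ.comp (fact_continuous hΓ g).measurable
  have hN1 : ∀ x, 1 ≤ N x := by
    intro x
    obtain ⟨g, hg⟩ := hcov x x.2
    have : χ (fact hΓ g x) = 1 := indicator_of_mem (show fact hΓ g x ∈ K' from hg) _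
    rw [← this]
    exact ENNReal.le_tsum (f := fun g => χ (fact hΓ g x)) g
  have hNtop : ∀ x, N x ≠ ⊤ := by
    intro x
    have hf := fuchsian_finite hΓ K hK hKc x x.2
    have hz : ∀ g ∉ hf.toFinset, χ (fact hΓ g x) = 0 := by
      intro g hg
      refine indicator_of_notMem (fun hh => hg ?_) _
      rw [Finite.mem_toFinset]; exact hh
    simp only [N]
    rw [tsum_eq_sum hz]
    refine (ENNReal.sum_lt_top.2 fun g _ => ?_).ne
    refine lt_of_le_of_lt (indicator_le_self' (fun _ _ => zero_le) _) ?_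
    simp
  have hNinv : ∀ g x, N (fact hΓ g x) = N x := by
    intro g x
    simp only [N]
    rw [← (Equiv.mulRight g).tsum_eq (fun k => χ (fact hΓ k x))]
    refine tsum_congr fun k => ?_
    congr 1
    exact Subtype.ext (hΓ.mul_act k g x x.2).symm
  refine ⟨fun x => χ x / N x, hχ.div hN, fun x => ?_, ?_⟩
  · simp_rw [hNinv, div_eq_mul_inv]
    rw [ENNReal.tsum_mul_right]
    exact ENNReal.mul_inv_cancel (zero_lt_one.trans_le (hN1 x)).ne' (hNtop x)
  · obtain ⟨r, hr, hKr⟩ := compact_norm_bound K hK hKc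
    have hle : ∫⁻ x, χ x / N x ∂hypMeas ≤ ∫⁻ x, χ x ∂hypMeas := by
      refine lintegral_mono fun x => ?_
      exact ENNReal.div_le_of_le_mul (le_mul_of_one_le_right zero_le (hN1 x))
    refine (hle.trans_lt ?_).ne
    simp only [χ]
    rw [lintegral_indicator_one hK'm]
    exact hypMeas_lt_top K' hK'm r hr fun z hz => hKr z hz

theorem joint_continuous (φ : ℂ → ℝ → ℝ)
    (hlip : ∀ E : Set ℂ, E ⊆ unitDisc → IsCompact E → ∃ L : NNReal,
      LipschitzOnWith L (fun p : ℂ × ℝ => φ p.1 p.2) (E ×ˢ Icc (0 : ℝ) 1)) :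
    ContinuousOn (fun p : ℂ × ℝ => φ p.1 p.2) (unitDisc ×ˢ Icc (0 : ℝ) 1) := by
  rintro ⟨z, t⟩ ⟨hz, ht⟩
  obtain ⟨r, hr, hsub⟩ := nhds_basis_closedBall.mem_iff.1 (unitDisc_open.mem_nhds hz)
  obtain ⟨L, hL⟩ := hlip _ hsub (isCompact_closedBall z r)
  have h1 := hL.continuousOn (z, t) ⟨mem_closedBall_self hr.le, ht⟩
  refine h1.mono_of_mem_nhdsWithin ?_
  have : (closedBall z r ×ˢ (univ : Set ℝ)) ∈ nhds (z, t) :=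
    prod_mem_nhds (closedBall_mem_nhds z hr) univ_mem
  filter_upwards [mem_nhdsWithin_of_mem_nhds this, self_mem_nhdsWithin] with p hp hq
  exact ⟨hp.1, hq.2⟩

open MeasureTheory in
theorem lipschitz_main
    {Γ : Type*} [Group Γ] (ρ : Γ → ℂ → ℂ) (hΓ : IsCocompactFuchsian Γ ρ)
    (z₀ : ℂ) (hz₀ : z₀ ∈ unitDisc) (φ : ℂ → ℝ → ℝ)
    (hharm : ∀ t ∈ Icc (0 : ℝ) 1, HarmonicOnSet (fun z => φ z t) unitDisc)
    (hmono : ∀ z ∈ unitDisc, StrictMonoOn (φ z) (Icc (0 : ℝ) 1))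
    (hsurj : ∀ z ∈ unitDisc, φ z '' Icc (0 : ℝ) 1 = Icc (0 : ℝ) 1)
    (hlip : ∀ E : Set ℂ, E ⊆ unitDisc → IsCompact E → ∃ L : NNReal,
      LipschitzOnWith L (fun p : ℂ × ℝ => φ p.1 p.2) (E ×ˢ Icc (0 : ℝ) 1))
    (hΓinv : ∀ γ : Γ, ∀ t ∈ Icc (0 : ℝ) 1, ∃ t' ∈ Icc (0 : ℝ) 1,
      ∀ z ∈ unitDisc, φ (ρ γ z) t = φ z t')
    (hnorm : ∀ t ∈ Icc (0 : ℝ) 1, φ z₀ t = t) :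
    ∀ z ∈ unitDisc, ∀ t ∈ Icc (0 : ℝ) 1, φ z t = t := by
  have hcount := fuchsian_countable hΓ
  have hsf := hypMeas_sfinite
  have hop := hypMeas_openPos
  have hjc := joint_continuous φ hlip
  have hmem : ∀ z ∈ unitDisc, ∀ t ∈ Icc (0 : ℝ) 1, φ z t ∈ Icc (0 : ℝ) 1 := by
    intro z hz t ht
    rw [← hsurj z hz]; exact mem_image_of_mem _ ht
  let F : unitDisc → unitInterval → unitInterval := fun x t => ⟨φ x t, hmem x x.2 t t.2⟩
  have hFm : ∀ x, StrictMono (F x) := fun x s t hst => hmono x x.2 s.2 t.2 hst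
  have hFs : ∀ x, Function.Surjective (F x) := by
    intro x t
    have : (t : ℝ) ∈ φ x '' Icc (0 : ℝ) 1 := by rw [hsurj x x.2]; exact t.2
    obtain ⟨s, hs, e⟩ := this
    exact ⟨⟨s, hs⟩, Subtype.ext e⟩
  let Φ : unitDisc → unitInterval ≃o unitInterval := fun x =>
    StrictMono.orderIsoOfSurjective (F x) (hFm x) (hFs x)
  have hΦval : ∀ x t, ((Φ x t : unitInterval) : ℝ) = φ x t := fun x t => rfl
  have hΦc : Continuous fun p : unitDisc × unitInterval => Φ p.1 p.2 := by
    have c1 : Continuous fun p : unitDisc × unitInterval => φ p.1 p.2 :=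
      hjc.comp_continuous (f := fun p : unitDisc × unitInterval => ((p.1 : ℂ), (p.2 : ℝ)))
        (by fun_prop) fun p => ⟨p.1.2, p.2.2⟩
    exact Continuous.subtype_mk c1 _
  obtain ⟨ψ, hψ, hψs, hψf⟩ := exists_weight hΓ
  have hcu : ∀ t ∈ Icc (0 : ℝ) 1, ContinuousOn (fun z => φ z t) unitDisc := by
    intro t ht
    exact hjc.comp (f := fun z : ℂ => (z, t)) (by fun_prop) fun z hz => ⟨hz, ht⟩
  have key := abstract_foliation hypMeas (fact hΓ)
    (fun x => Subtype.ext (hΓ.one_act x x.2))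
    (fun g k x => Subtype.ext (hΓ.mul_act g k x x.2))
    (fun g => by
      obtain ⟨α, β, h, e⟩ := fact_mob hΓ g
      rw [e]
      exact mob_preserving h (mobX h) (fun _ => rfl) (mobX_continuous h).measurable)
    ψ hψ hψs hψf nearS nearS_open.measurableSet nearS_symm
    (fun g x y => by
      obtain ⟨α, β, h, e⟩ := fact_mob hΓ g
      rw [e]
      exact nearS_mob h x y _ _ rfl rfl)
    (hypMeas {y | (zeroX, y) ∈ nearS}) slice_zero_lt_top.ne slice_eq Φ hΦc
    (fun g t => by
      obtain ⟨t', ht', e⟩ := hΓinv g t t.2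
      exact ⟨⟨t', ht'⟩, fun x => Subtype.ext (e x x.2)⟩)
    (fun x t => mean_value (fun z => φ z t) (hharm t t.2) (hcu t t.2)
      (fun z hz => by
        have := hmem z hz t t.2
        rw [abs_of_nonneg this.1]; exact this.2) x)
  intro z hz t ht
  have hcX : Continuous (fun x : unitDisc => φ x t) :=
    continuousOn_iff_continuous_domRestrict.1 (hcu t ht)
  have hdense : Dense {x : unitDisc | ∀ᵐ y ∂hypMeas, (x, y) ∈ nearS → Φ y = Φ x} :=
    Measure.dense_of_ae key
  have hslo : ∀ x : unitDisc, IsOpen {y | (x, y) ∈ nearS} := fun x =>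
    nearS_open.preimage (Continuous.prodMk_right x)
  have hgood : ∀ x : unitDisc, (∀ᵐ y ∂hypMeas, (x, y) ∈ nearS → Φ y = Φ x) →
      ∀ y, (x, y) ∈ nearS → φ y t = φ x t := by
    intro x hx y hy
    by_contra hne
    have ho : IsOpen ({y : unitDisc | (x, y) ∈ nearS} ∩ {y : unitDisc | φ y t ≠ φ x t}) :=
      (hslo x).inter (isOpen_ne_fun hcX continuous_const)
    refine ho.measure_ne_zero hypMeas ⟨y, hy, hne⟩ ?_
    refine measure_mono_null (fun w hw => ?_) (ae_iff.1 hx)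
    intro hw2
    refine hw.2 ?_
    have e := congrArg (fun f : unitInterval ≃o unitInterval => ((f ⟨t, ht⟩ : unitInterval) : ℝ))
      (hw2 hw.1)
    exact e
  have hlc : IsLocallyConstant (fun x : unitDisc => φ x t) := by
    rw [IsLocallyConstant.iff_eventually_eq]
    intro x
    have hev : ∀ᶠ w in nhds x, (w, x) ∈ nearS :=
      (nearS_open.preimage (Continuous.prodMk_left x)).mem_nhds (nearS_self x)
    obtain ⟨w, hw, hwx⟩ := hdense.inter_nhds_nonempty hev
    filter_upwards [(hslo w).mem_nhds hwx] with y hy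
    rw [hgood w hw y hy, hgood w hw x hwx]
  have hpre : PreconnectedSpace unitDisc :=
    Subtype.preconnectedSpace (convex_ball (0 : ℂ) 1).isPreconnected
  have e := hlc.apply_eq_of_isPreconnected isPreconnected_univ (mem_univ ⟨z, hz⟩)
    (mem_univ ⟨z₀, hz₀⟩)
  exact e.trans (hnorm t ht)

/-- **Proposition 10.1 (a Lipschitz harmonic foliation is a product), base a compact
hyperbolic surface.** Let `Γ` be a cocompact Fuchsian group and `φ : 𝔻 × [0,1] → [0,1]` a
`Γ`-invariant, Lipschitz, harmonic foliated family of graphs which restricts on each fiber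
to a strictly increasing continuous bijection of `[0,1]` and is normalized over `z₀`.
Then `φ(z,t) = t`: the foliation is the product foliation. -/
theorem lipschitz_harmonic_foliation_is_product
    {Γ : Type*} [Group Γ] (ρ : Γ → ℂ → ℂ) (hΓ : IsCocompactFuchsian Γ ρ)
    (z₀ : ℂ) (hz₀ : z₀ ∈ unitDisc) (φ : ℂ → ℝ → ℝ)
    -- (i) each leaf is the graph of a harmonic function
    (hharm : ∀ t ∈ Icc (0 : ℝ) 1, HarmonicOnSet (fun z => φ z t) unitDisc)
    -- (ii) on each fiber, a strictly increasing continuous bijection of [0,1] onto itself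
    (hmono : ∀ z ∈ unitDisc, StrictMonoOn (φ z) (Icc (0 : ℝ) 1))
    (hcont : ∀ z ∈ unitDisc, ContinuousOn (φ z) (Icc (0 : ℝ) 1))
    (hsurj : ∀ z ∈ unitDisc, φ z '' Icc (0 : ℝ) 1 = Icc (0 : ℝ) 1)
    -- (iii) Lipschitz on E × [0,1] for every compact E ⊆ 𝔻
    (hlip : ∀ E : Set ℂ, E ⊆ unitDisc → IsCompact E → ∃ L : NNReal,
      LipschitzOnWith L (fun p : ℂ × ℝ => φ p.1 p.2) (E ×ˢ Icc (0 : ℝ) 1))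
    -- (iv) the family of graphs is Γ-invariant
    (hΓinv : ∀ γ : Γ, ∀ t ∈ Icc (0 : ℝ) 1, ∃ t' ∈ Icc (0 : ℝ) 1,
      ∀ z ∈ unitDisc, φ (ρ γ z) t = φ z t')
    -- (v) normalization over z₀
    (hnorm : ∀ t ∈ Icc (0 : ℝ) 1, φ z₀ t = t) :
    ∀ z ∈ unitDisc, ∀ t ∈ Icc (0 : ℝ) 1, φ z t = t := by
  exact lipschitz_main ρ hΓ z₀ hz₀ φ hharm hmono hsurj hlip hΓinv hnorm
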